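/- For all n, k ≥ 1, the tree net T_Δ^{n,k} has decomposition width 2, i.e. there exists a wiring decomposition of T_Δ^{n,k} of width 2. -/

import Mathlib

/-! Core definitions: nets with boundaries (Sobocinski et al.),
composition, tensor, isomorphism, step firing semantics, ports,
connections, networks, bases, wiring expressions and decompositions. -/

namespace NWB

/-- A net with boundaries `N : k → l` (without the contention axioms,
which are packaged separately in `IsContention`). -/
structure NetB (k l : ℕ) : Type 1 where
  P : Type
  T : Type
  finP : Finite P
  finT : Finite T
  pre : T → Set P
  post : T → Set P
  src : T → Set (Fin k)
  tgt : T → Set (Fin l)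
  con : T → T → Prop

/-- The contention relation axioms: reflexive, symmetric, and forced whenever
two transitions share a pre-place, post-place, or boundary port. -/
def IsContention {k l : ℕ} (N : NetB k l) : Prop :=
  (∀ t, N.con t t) ∧ (∀ t u, N.con t u → N.con u t) ∧
  (∀ t u,
    ((N.pre t ∩ N.pre u).Nonempty ∨ (N.post t ∩ N.post u).Nonempty ∨
     (N.src t ∩ N.src u).Nonempty ∨ (N.tgt t ∩ N.tgt u).Nonempty) → N.con t u)

def setPre {k l : ℕ} (N : NetB k l) (U : Set N.T) : Set N.P := ⋃ u ∈ U, N.pre u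
def setPost {k l : ℕ} (N : NetB k l) (U : Set N.T) : Set N.P := ⋃ u ∈ U, N.post u
def setSrc {k l : ℕ} (N : NetB k l) (U : Set N.T) : Set (Fin k) := ⋃ u ∈ U, N.src u
def setTgt {k l : ℕ} (N : NetB k l) (U : Set N.T) : Set (Fin l) := ⋃ u ∈ U, N.tgt u

/-- Mutually independent set of transitions: no two distinct members in contention. -/
def MI {k l : ℕ} (N : NetB k l) (U : Set N.T) : Prop :=
  ∀ u ∈ U, ∀ v ∈ U, N.con u v → u = v

/-- Contention lifted to sets of transitions. -/
def setCon {k l : ℕ} (N : NetB k l) (U V : Set N.T) : Prop :=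
  ∃ u ∈ U, ∃ v ∈ V, N.con u v

/-- A synchronisation between `M : l → m` and `N : m → n`. -/
structure Sync {l m n : ℕ} (M : NetB l m) (N : NetB m n) where
  U : Set M.T
  V : Set N.T
  miU : MI M U
  miV : MI N V
  bd : setTgt M U = setSrc N V

def Sync.Trivial {l m n : ℕ} {M : NetB l m} {N : NetB m n} (s : Sync M N) : Prop :=
  s.U = ∅ ∧ s.V = ∅

/-- A minimal synchronisation: non-trivial, and every componentwise-smaller
synchronisation is trivial or equal to it. -/
def Sync.Minimal {l m n : ℕ} {M : NetB l m} {N : NetB m n} (s : Sync M N) : Prop :=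
  ¬ s.Trivial ∧
  ∀ s' : Sync M N, s'.U ⊆ s.U → s'.V ⊆ s.V → (s'.Trivial ∨ (s'.U = s.U ∧ s'.V = s.V))

theorem sync_finite {l m n : ℕ} (M : NetB l m) (N : NetB m n) : Finite (Sync M N) := by
  haveI := M.finT; haveI := N.finT
  apply Finite.of_injective (fun s : Sync M N => (s.U, s.V))
  intro s s' h
  simp only [Prod.mk.injEq] at h
  obtain ⟨h1, h2⟩ := h
  cases s; cases s'
  simp_all

/-- Composition along a common boundary. -/
def comp {l m n : ℕ} (M : NetB l m) (N : NetB m n) : NetB l n where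
  P := M.P ⊕ N.P
  T := {s : Sync M N // s.Minimal}
  finP := by haveI := M.finP; haveI := N.finP; exact inferInstance
  finT := by haveI := sync_finite M N; exact inferInstance
  pre s := (Sum.inl '' setPre M s.1.U) ∪ (Sum.inr '' setPre N s.1.V)
  post s := (Sum.inl '' setPost M s.1.U) ∪ (Sum.inr '' setPost N s.1.V)
  src s := setSrc M s.1.U
  tgt s := setTgt N s.1.V
  con s s' := setCon M s.1.U s'.1.U ∨ setCon N s.1.V s'.1.V

/-- Tensor product of nets with boundaries. -/
def tensor {l m k n : ℕ} (M : NetB l m) (N : NetB k n) : NetB (l + k) (m + n) where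
  P := M.P ⊕ N.P
  T := M.T ⊕ N.T
  finP := by haveI := M.finP; haveI := N.finP; exact inferInstance
  finT := by haveI := M.finT; haveI := N.finT; exact inferInstance
  pre t := match t with
    | Sum.inl t => Sum.inl '' M.pre t
    | Sum.inr t => Sum.inr '' N.pre t
  post t := match t with
    | Sum.inl t => Sum.inl '' M.post t
    | Sum.inr t => Sum.inr '' N.post t
  src t := match t with
    | Sum.inl t => Fin.castAdd k '' M.src t
    | Sum.inr t => Fin.natAdd l '' N.src t
  tgt t := match t with
    | Sum.inl t => Fin.castAdd n '' M.tgt t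
    | Sum.inr t => Fin.natAdd m '' N.tgt t
  con t u := match t, u with
    | Sum.inl t, Sum.inl u => M.con t u
    | Sum.inr t, Sum.inr u => N.con t u
    | _, _ => False

/-- Isomorphism of nets with boundaries: bijections on places and transitions
preserving pre-sets, post-sets, boundary maps and contention. -/
structure NetIso {k l : ℕ} (M N : NetB k l) where
  ep : M.P ≃ N.P
  et : M.T ≃ N.T
  pre_eq : ∀ t, N.pre (et t) = ep '' M.pre t
  post_eq : ∀ t, N.post (et t) = ep '' M.post t
  src_eq : ∀ t, N.src (et t) = M.src t
  tgt_eq : ∀ t, N.tgt (et t) = M.tgt t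
  con_iff : ∀ t u, N.con (et t) (et u) ↔ M.con t u

def Iso {k l : ℕ} (M N : NetB k l) : Prop := Nonempty (NetIso M N)

/-- Transport a net along equalities of its boundary sizes. -/
def castNet {k l k' l' : ℕ} (h1 : k = k') (h2 : l = l') (N : NetB k l) : NetB k' l' where
  P := N.P
  T := N.T
  finP := N.finP
  finT := N.finT
  pre := N.pre
  post := N.post
  src t := Fin.cast h1 '' N.src t
  tgt t := Fin.cast h2 '' N.tgt t
  con := N.con

def emptyNet : NetB 0 0 where
  P := Empty
  T := Empty
  finP := inferInstance
  finT := inferInstance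
  pre t := t.elim
  post t := t.elim
  src t := t.elim
  tgt t := t.elim
  con t _ := t.elim

/-- The step firing semantics: `Fires N X X' α β` iff the LTS `⟦N⟧` has a
transition `X →⟨α,β⟩ X'`. -/
def Fires {k l : ℕ} (N : NetB k l) (X X' : Set N.P) (α : Set (Fin k)) (β : Set (Fin l)) :
    Prop :=
  ∃ U : Set N.T, MI N U ∧ setPre N U ⊆ X ∧ setPost N U ∩ X = ∅ ∧
    X' = (X \ setPre N U) ∪ setPost N U ∧ setSrc N U = α ∧ setTgt N U = β

/-! ### Ports, connections and networks -/

/-- The ports of a net: an in-port and an out-port for each place,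
together with the left and right boundary ports. -/
def Port {k l : ℕ} (N : NetB k l) : Type := (N.P ⊕ N.P) ⊕ (Fin k ⊕ Fin l)

def portIn {k l : ℕ} {N : NetB k l} (p : N.P) : Port N := Sum.inl (Sum.inl p)
def portOut {k l : ℕ} {N : NetB k l} (p : N.P) : Port N := Sum.inl (Sum.inr p)
def bLeft {k l : ℕ} {N : NetB k l} (i : Fin k) : Port N := Sum.inr (Sum.inl i)
def bRight {k l : ℕ} {N : NetB k l} (j : Fin l) : Port N := Sum.inr (Sum.inr j)

/-- The portset of a transition. -/
def tports {k l : ℕ} (N : NetB k l) (t : N.T) : Set (Port N) :=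
  (portOut '' N.pre t) ∪ (portIn '' N.post t) ∪ (bLeft '' N.src t) ∪ (bRight '' N.tgt t)

/-- The connection of a port `q`: the portsets (minus `q`) of all transitions
properly connecting to `q`. -/
def conn {k l : ℕ} (N : NetB k l) (q : Port N) : Set (Set (Port N)) :=
  { K | ∃ t : N.T, {q} ⊂ tports N t ∧ K = tports N t \ {q} }

/-- The connection of `q` restricted to a set `R` of ports. -/
def connR {k l : ℕ} (N : NetB k l) (R : Set (Port N)) (q : Port N) :
    Set (Set (Port N)) :=
  { K' | ∃ K ∈ conn N q, (K ∩ R).Nonempty ∧ K' = K ∩ R }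

/-- Extended ports of the left part of an oriented partition. -/
def eportsL {k l : ℕ} (N : NetB k l) (Pl : Set N.P) : Set (Port N) :=
  (portIn '' Pl) ∪ (portOut '' Pl) ∪ Set.range (bLeft (N := N))

/-- Extended ports of the right part of an oriented partition. -/
def eportsR {k l : ℕ} (N : NetB k l) (Pr : Set N.P) : Set (Port N) :=
  (portIn '' Pr) ∪ (portOut '' Pr) ∪ Set.range (bRight (N := N))

/-- The network `net(P_l → P_r)`. -/
def networkLR {k l : ℕ} (N : NetB k l) (Pl Pr : Set N.P) :
    Set (Set (Set (Port N))) :=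
  { c | ∃ q ∈ eportsL N Pl, c = connR N (eportsR N Pr) q }

/-- The network `net(P_r → P_l)`. -/
def networkRL {k l : ℕ} (N : NetB k l) (Pl Pr : Set N.P) :
    Set (Set (Set (Port N))) :=
  { c | ∃ q ∈ eportsR N Pr, c = connR N (eportsL N Pl) q }

/-- `b` is a basis of the network `M`: every connection in `M` is a union of
basis connections. -/
def IsBasis {C : Type} {m : ℕ} (b : Fin m → Set C) (M : Set (Set C)) : Prop :=
  ∀ c ∈ M, ∃ S : Finset (Fin m), c = ⋃ i ∈ S, b i

/-- The dimension of a network: the size of its smallest basis. -/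
noncomputable def netDim {C : Type} (M : Set (Set C)) : ℕ :=
  sInf { m | ∃ b : Fin m → Set C, IsBasis b M }

/-- Purity of a composition `N_l ; N_r`: no transition of either component
connects to two different shared boundary ports. -/
def Pure {k n l : ℕ} (Nl : NetB k n) (Nr : NetB n l) : Prop :=
  (∀ j : Fin n, ∀ K ∈ conn Nl (bRight j), ∀ i : Fin n, bRight i ∉ K) ∧
  (∀ j : Fin n, ∀ K ∈ conn Nr (bLeft j), ∀ i : Fin n, bLeft i ∉ K)

/-! ### Wiring expressions and decompositions -/

/-- Nets with boundaries of arbitrary boundary sizes. -/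
def NetS : Type 1 := Σ (k : ℕ) (l : ℕ), NetB k l

/-- Composition on `NetS` (junk value on boundary mismatch). -/
def seqS (X Y : NetS) : NetS :=
  if h : X.2.1 = Y.1 then ⟨X.1, Y.2.1, comp (castNet rfl h X.2.2) Y.2.2⟩
  else ⟨0, 0, emptyNet⟩

def tenS (X Y : NetS) : NetS := ⟨X.1 + Y.1, X.2.1 + Y.2.1, tensor X.2.2 Y.2.2⟩

/-- Wiring expressions: binary trees with `;` and `⊗` nodes and variables at
the leaves. -/
inductive WExpr (V : Type) : Type
  | leaf : V → WExpr V
  | seq : WExpr V → WExpr V → WExpr V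
  | ten : WExpr V → WExpr V → WExpr V

/-- Semantics of a wiring expression under a variable assignment. -/
def sem {V : Type} (A : V → NetS) : WExpr V → NetS
  | .leaf x => A x
  | .seq t₁ t₂ => seqS (sem A t₁) (sem A t₂)
  | .ten t₁ t₂ => tenS (sem A t₁) (sem A t₂)

/-- Compatibility of an assignment with an expression: at each `;` node the
shared boundaries match. -/
def WT {V : Type} (A : V → NetS) : WExpr V → Prop
  | .leaf _ => True
  | .seq t₁ t₂ => WT A t₁ ∧ WT A t₂ ∧ (sem A t₁).2.1 = (sem A t₂).1
  | .ten t₁ t₂ => WT A t₁ ∧ WT A t₂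

/-- The wiring decomposition `(t, A)` has width `w`: every leaf net has
boundaries and number of places `≤ w`, and every subexpression has
boundaries `≤ w`. -/
def HasWidth {V : Type} (A : V → NetS) (w : ℕ) : WExpr V → Prop
  | .leaf x => (A x).1 ≤ w ∧ Nat.card (A x).2.2.P ≤ w ∧ (A x).2.1 ≤ w
  | .seq t₁ t₂ => HasWidth A w t₁ ∧ HasWidth A w t₂ ∧
      (sem A (.seq t₁ t₂)).1 ≤ w ∧ (sem A (.seq t₁ t₂)).2.1 ≤ w
  | .ten t₁ t₂ => HasWidth A w t₁ ∧ HasWidth A w t₂ ∧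
      (sem A (.ten t₁ t₂)).1 ≤ w ∧ (sem A (.ten t₁ t₂)).2.1 ≤ w

/-- `(t, A)` is a wiring decomposition of `N : k → l`: the assignment maps
variables to genuine nets with boundaries, is compatible with `t`, and
`⟦t⟧_A ≅ N`. -/
def IsDecompOf {V : Type} {k l : ℕ} (A : V → NetS) (t : WExpr V) (N : NetB k l) : Prop :=
  (∀ x, IsContention (A x).2.2) ∧ WT A t ∧
  ∃ (h1 : (sem A t).1 = k) (h2 : (sem A t).2.1 = l),
    Iso (castNet h1 h2 (sem A t).2.2) N

/-- A net has decomposition width `w` if it has a wiring decomposition of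
width `w`. -/
def HasDecompWidth {k l : ℕ} (N : NetB k l) (w : ℕ) : Prop :=
  ∃ (Var : Type) (A : Var → NetS) (t : WExpr Var),
    IsDecompOf A t N ∧ HasWidth A w t

/-- A pure wiring decomposition: at every `;` node the composition of the two
subexpression nets is pure. -/
def PureExpr {V : Type} (A : V → NetS) : WExpr V → Prop
  | .leaf _ => True
  | .seq t₁ t₂ => PureExpr A t₁ ∧ PureExpr A t₂ ∧
      ∀ (h : (sem A t₁).2.1 = (sem A t₂).1),
        Pure (castNet rfl h (sem A t₁).2.2) (sem A t₂).2.2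
  | .ten t₁ t₂ => PureExpr A t₁ ∧ PureExpr A t₂

/-- One step of reassociation of `;` or `⊗`, anywhere inside an expression. -/
inductive AssocStep {V : Type} : WExpr V → WExpr V → Prop
  | seqAssoc (a b c : WExpr V) : AssocStep (.seq (.seq a b) c) (.seq a (.seq b c))
  | tenAssoc (a b c : WExpr V) : AssocStep (.ten (.ten a b) c) (.ten a (.ten b c))
  | seqCongrL {a a' : WExpr V} (b : WExpr V) :
      AssocStep a a' → AssocStep (.seq a b) (.seq a' b)
  | seqCongrR (a : WExpr V) {b b' : WExpr V} :
      AssocStep b b' → AssocStep (.seq a b) (.seq a b')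
  | tenCongrL {a a' : WExpr V} (b : WExpr V) :
      AssocStep a a' → AssocStep (.ten a b) (.ten a' b)
  | tenCongrR (a : WExpr V) {b b' : WExpr V} :
      AssocStep b b' → AssocStep (.ten a b) (.ten a b')

/-- Equivalence of wiring expressions up to associativity of `;` and `⊗`. -/
def AssocEquiv {V : Type} : WExpr V → WExpr V → Prop := Relation.EqvGen AssocStep

/-! ### Concrete families of nets -/

/-- The clique net `C_n : 0 → 0`, with the minimal contention relation. -/
def clique (n : ℕ) : NetB 0 0 where
  P := Fin n
  T := {p : Fin n × Fin n // p.1 ≠ p.2}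
  finP := inferInstance
  finT := inferInstance
  pre t := {t.1.1}
  post t := {t.1.2}
  src _ := ∅
  tgt _ := ∅
  con t u := t.1.1 = u.1.1 ∨ t.1.2 = u.1.2

/-- The subset net `P_n : 0 → 0`: a place `S` (= `none`), places `[n]`, and for
each `A ⊆ [n]` a transition `S → A`; the minimal contention relation is total
since all pre-sets are `{S}`. -/
def subsetNet (n : ℕ) : NetB 0 0 where
  P := Option (Fin n)
  T := Set (Fin n)
  finP := inferInstance
  finT := inferInstance
  pre _ := {none}
  post A := some '' A
  src _ := ∅
  tgt _ := ∅
  con _ _ := True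

/-- The tree net `T_Δ^{n,k} : 0 → 0`: places are nodes of the complete n-ary
tree of depth k (lists over `Fin n` of length ≤ k); each non-leaf node has a
single transition to the set of its n children. The minimal contention
relation is equality. -/
def treeD (n k : ℕ) : NetB 0 0 where
  P := {l : List (Fin n) // l.length ≤ k}
  T := {l : List (Fin n) // l.length < k}
  finP := (List.finite_length_le (Fin n) k).to_subtype
  finT := (List.finite_length_lt (Fin n) k).to_subtype
  pre t := {⟨t.1, t.2.le⟩}
  post t := {p | ∃ i : Fin n, p.1 = t.1 ++ [i]}
  src _ := ∅
  tgt _ := ∅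
  con t u := t = u

/-- The tree net `T_Λ^{n,k} : 0 → 0`: as `T_Δ^{n,k}` but with a separate
transition from each non-leaf node to each of its children. The minimal
contention relation relates transitions with the same parent node. -/
def treeL (n k : ℕ) : NetB 0 0 where
  P := {l : List (Fin n) // l.length ≤ k}
  T := {l : List (Fin n) // l.length < k} × Fin n
  finP := (List.finite_length_le (Fin n) k).to_subtype
  finT := by
    haveI : Finite {l : List (Fin n) // l.length < k} :=
      (List.finite_length_lt (Fin n) k).to_subtype
    exact inferInstance
  pre t := {⟨t.1.1, t.1.2.le⟩}
  post t := {p | p.1 = t.1.1 ++ [t.2]}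
  src _ := ∅
  tgt _ := ∅
  con t u := t.1 = u.1

/-- The grid net `G_n : 0 → 0`: places `[n] × [n]`, a transition from each
place to its right neighbour and to its lower neighbour; the minimal
contention relation relates transitions sharing a pre-place or post-place. -/
def grid (n : ℕ) : NetB 0 0 where
  P := Fin n × Fin n
  T := {e : (Fin n × Fin n) × (Fin n × Fin n) //
        (e.2.1 = e.1.1 ∧ (e.2.2 : ℕ) = (e.1.2 : ℕ) + 1) ∨
        ((e.2.1 : ℕ) = (e.1.1 : ℕ) + 1 ∧ e.2.2 = e.1.2)}
  finP := inferInstance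
  finT := inferInstance
  pre e := {e.1.1}
  post e := {e.1.2}
  src _ := ∅
  tgt _ := ∅
  con t u := t.1.1 = u.1.1 ∨ t.1.2 = u.1.2

end NWB

namespace NWB

/-- Reducible copy of `tensor`. -/
@[reducible] def rtensor {l m k n : ℕ} (M : NetB l m) (N : NetB k n) : NetB (l + k) (m + n) where
  P := M.P ⊕ N.P
  T := M.T ⊕ N.T
  finP := by haveI := M.finP; haveI := N.finP; exact inferInstance
  finT := by haveI := M.finT; haveI := N.finT; exact inferInstance
  pre t := match t with
    | Sum.inl t => Sum.inl '' M.pre t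
    | Sum.inr t => Sum.inr '' N.pre t
  post t := match t with
    | Sum.inl t => Sum.inl '' M.post t
    | Sum.inr t => Sum.inr '' N.post t
  src t := match t with
    | Sum.inl t => Fin.castAdd k '' M.src t
    | Sum.inr t => Fin.natAdd l '' N.src t
  tgt t := match t with
    | Sum.inl t => Fin.castAdd n '' M.tgt t
    | Sum.inr t => Fin.natAdd m '' N.tgt t
  con t u := match t, u with
    | Sum.inl t, Sum.inl u => M.con t u
    | Sum.inr t, Sum.inr u => N.con t u
    | _, _ => False

/-- Reducible copy of `treeD`. -/
@[reducible] def rtreeD (n k : ℕ) : NetB 0 0 where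
  P := {l : List (Fin n) // l.length ≤ k}
  T := {l : List (Fin n) // l.length < k}
  finP := (List.finite_length_le (Fin n) k).to_subtype
  finT := (List.finite_length_lt (Fin n) k).to_subtype
  pre t := {⟨t.1, t.2.le⟩}
  post t := {p | ∃ i : Fin n, p.1 = t.1 ++ [i]}
  src _ := ∅
  tgt _ := ∅
  con t u := t = u

/-- Contention is equality. -/
def ConEq {k l : ℕ} (N : NetB k l) : Prop := ∀ a b, N.con a b ↔ a = b

/-- An explicit description of the composition of two nets. -/
structure CompDat {l m n : ℕ} (M : NetB l m) (N : NetB m n) (K : NetB l n) where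
  ep : M.P ⊕ N.P ≃ K.P
  f : K.T → Set M.T
  g : K.T → Set N.T
  bd : ∀ t, setTgt M (f t) = setSrc N (g t)
  ne : ∀ t, (f t).Nonempty ∨ (g t).Nonempty
  cov : ∀ (U : Set M.T) (V : Set N.T), setTgt M U = setSrc N V → (U.Nonempty ∨ V.Nonempty) →
    ∃ t, f t ⊆ U ∧ g t ⊆ V
  dis : ∀ t t', ((f t ∩ f t').Nonempty ∨ (g t ∩ g t').Nonempty) → t = t'
  pre_eq : ∀ t, K.pre t = ep '' ((Sum.inl '' setPre M (f t)) ∪ (Sum.inr '' setPre N (g t)))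
  post_eq : ∀ t, K.post t = ep '' ((Sum.inl '' setPost M (f t)) ∪ (Sum.inr '' setPost N (g t)))
  src_eq : ∀ t, K.src t = setSrc M (f t)
  tgt_eq : ∀ t, K.tgt t = setTgt N (g t)

theorem ConEq.mi {k l : ℕ} {N : NetB k l} (h : ConEq N) (U : Set N.T) : MI N U :=
  fun u _ v _ huv => (h u v).1 huv

theorem CompDat.iso {l m n : ℕ} {M : NetB l m} {N : NetB m n} {K : NetB l n}
    (D : CompDat M N K) (hM : ConEq M) (hN : ConEq N) (hK : ConEq K) :
    Iso (comp M N) K := by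
  let s : K.T → Sync M N := fun t => ⟨D.f t, D.g t, hM.mi _, hN.mi _, D.bd t⟩
  have key : ∀ (r : Sync M N), ¬ r.Trivial → ∃ t, D.f t ⊆ r.U ∧ D.g t ⊆ r.V := by
    intro r hr
    apply D.cov _ _ r.bd
    by_contra hc
    push Not at hc
    exact hr hc
  have nt : ∀ t, ¬ (s t).Trivial := by
    intro t ht
    have h1 : D.f t = ∅ := ht.1
    have h2 : D.g t = ∅ := ht.2
    rcases D.ne t with h | h
    · rw [h1] at h; exact Set.not_nonempty_empty h
    · rw [h2] at h; exact Set.not_nonempty_empty h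
  have sub : ∀ t t', D.f t ⊆ D.f t' → D.g t ⊆ D.g t' → t = t' := by
    intro t t' h1 h2
    apply D.dis
    rcases D.ne t with ⟨x, h⟩ | ⟨x, h⟩
    · exact Or.inl ⟨x, h, h1 h⟩
    · exact Or.inr ⟨x, h, h2 h⟩
  have mn : ∀ t, (s t).Minimal := by
    intro t
    refine ⟨nt t, fun r h1 h2 => ?_⟩
    by_cases hr : r.Trivial
    · exact Or.inl hr
    · obtain ⟨t', h3, h4⟩ := key r hr
      have : t' = t := sub _ _ (h3.trans h1) (h4.trans h2)
      subst this
      exact Or.inr ⟨h1.antisymm h3, h2.antisymm h4⟩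
  let F : K.T → (comp M N).T := fun t => ⟨s t, mn t⟩
  have hF : Function.Bijective F := by
    constructor
    · intro t t' h
      have h' : s t = s t' := congrArg Subtype.val h
      have h1 : D.f t = D.f t' := congrArg Sync.U h'
      have h2 : D.g t = D.g t' := congrArg Sync.V h'
      exact sub _ _ h1.le h2.le
    · rintro ⟨r, hr⟩
      obtain ⟨t, h3, h4⟩ := key r hr.1
      refine ⟨t, ?_⟩
      apply Subtype.ext
      rcases hr.2 (s t) h3 h4 with h | ⟨h5, h6⟩
      · exact absurd h (nt t)
      · show s t = r
        cases r
        simp only [s] at h5 h6 ⊢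
        subst h5; subst h6; rfl
  let e := Equiv.ofBijective F hF
  have all : ∀ {p : (comp M N).T → Prop}, (∀ t, p (F t)) → ∀ x, p x := by
    intro p h x
    obtain ⟨t, rfl⟩ := hF.2 x
    exact h t
  have es : ∀ t, e.symm (F t) = t := fun t => e.symm_apply_apply t
  refine ⟨⟨D.ep, e.symm, ?_, ?_, ?_, ?_, ?_⟩⟩
  · apply all; intro t; rw [es]; exact D.pre_eq t
  · apply all; intro t; rw [es]; exact D.post_eq t
  · apply all; intro t; rw [es]; exact D.src_eq t
  · apply all; intro t; rw [es]; exact D.tgt_eq t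
  · apply all; intro t; apply all; intro t'; rw [es, es, hK]
    constructor
    · rintro rfl
      rcases D.ne t with ⟨x, h⟩ | ⟨x, h⟩
      · exact Or.inl ⟨x, h, x, h, (hM _ _).2 rfl⟩
      · exact Or.inr ⟨x, h, x, h, (hN _ _).2 rfl⟩
    · rintro (⟨x, h, y, h', hxy⟩ | ⟨x, h, y, h', hxy⟩)
      · have := (hM _ _).1 hxy; subst this
        exact D.dis _ _ (Or.inl ⟨x, h, h'⟩)
      · have := (hN _ _).1 hxy; subst this
        exact D.dis _ _ (Or.inr ⟨x, h, h'⟩)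

theorem NetIso.setTgt_pre {k l : ℕ} {M M' : NetB k l} (i : NetIso M M') (U : Set M'.T) :
    setTgt M (i.et ⁻¹' U) = setTgt M' U := by
  ext x
  simp only [setTgt, Set.mem_iUnion, Set.mem_preimage, exists_prop]
  constructor
  · rintro ⟨t, h, h'⟩; exact ⟨_, h, by rwa [i.tgt_eq]⟩
  · rintro ⟨t, h, h'⟩
    obtain ⟨t, rfl⟩ := i.et.surjective t
    exact ⟨_, h, by rwa [← i.tgt_eq]⟩

theorem NetIso.setSrc_pre {k l : ℕ} {M M' : NetB k l} (i : NetIso M M') (U : Set M'.T) :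
    setSrc M (i.et ⁻¹' U) = setSrc M' U := by
  ext x
  simp only [setSrc, Set.mem_iUnion, Set.mem_preimage, exists_prop]
  constructor
  · rintro ⟨t, h, h'⟩; exact ⟨_, h, by rwa [i.src_eq]⟩
  · rintro ⟨t, h, h'⟩
    obtain ⟨t, rfl⟩ := i.et.surjective t
    exact ⟨_, h, by rwa [← i.src_eq]⟩

theorem NetIso.setPre_pre {k l : ℕ} {M M' : NetB k l} (i : NetIso M M') (U : Set M'.T) :
    i.ep '' setPre M (i.et ⁻¹' U) = setPre M' U := by
  ext x
  simp only [setPre, Set.mem_iUnion, Set.mem_preimage, exists_prop, Set.mem_image]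
  constructor
  · rintro ⟨y, ⟨t, h, h'⟩, rfl⟩; exact ⟨_, h, by rw [i.pre_eq]; exact ⟨y, h', rfl⟩⟩
  · rintro ⟨t, h, h'⟩
    obtain ⟨t, rfl⟩ := i.et.surjective t
    rw [i.pre_eq] at h'
    obtain ⟨y, hy, rfl⟩ := h'
    exact ⟨y, ⟨t, h, hy⟩, rfl⟩

theorem NetIso.setPost_pre {k l : ℕ} {M M' : NetB k l} (i : NetIso M M') (U : Set M'.T) :
    i.ep '' setPost M (i.et ⁻¹' U) = setPost M' U := by
  ext x
  simp only [setPost, Set.mem_iUnion, Set.mem_preimage, exists_prop, Set.mem_image]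
  constructor
  · rintro ⟨y, ⟨t, h, h'⟩, rfl⟩; exact ⟨_, h, by rw [i.post_eq]; exact ⟨y, h', rfl⟩⟩
  · rintro ⟨t, h, h'⟩
    obtain ⟨t, rfl⟩ := i.et.surjective t
    rw [i.post_eq] at h'
    obtain ⟨y, hy, rfl⟩ := h'
    exact ⟨y, ⟨t, h, hy⟩, rfl⟩

theorem NetIso.conEq {k l : ℕ} {M M' : NetB k l} (i : NetIso M M') (h : ConEq M') : ConEq M := by
  intro a b
  rw [← i.con_iff, h, i.et.apply_eq_iff_eq]

theorem Iso.conEq {k l : ℕ} {M M' : NetB k l} (i : Iso M M') (h : ConEq M') : ConEq M :=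
  i.elim fun i => i.conEq h

theorem Iso.trans {k l : ℕ} {A B C : NetB k l} (h : Iso A B) (h' : Iso B C) : Iso A C := by
  obtain ⟨i⟩ := h
  obtain ⟨j⟩ := h'
  refine ⟨⟨i.ep.trans j.ep, i.et.trans j.et, ?_, ?_, ?_, ?_, ?_⟩⟩
  · intro t; simp [j.pre_eq, i.pre_eq, Set.image_image]
  · intro t; simp [j.post_eq, i.post_eq, Set.image_image]
  · intro t; simp [j.src_eq, i.src_eq]
  · intro t; simp [j.tgt_eq, i.tgt_eq]
  · intro t u; simp [j.con_iff, i.con_iff]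

/-- Transport along an isomorphism of the left component. -/
def CompDat.left {l m n : ℕ} {M M' : NetB l m} {N : NetB m n} {K : NetB l n}
    (D : CompDat M' N K) (i : NetIso M M') : CompDat M N K where
  ep := (Equiv.sumCongr i.ep (Equiv.refl _)).trans D.ep
  f t := i.et ⁻¹' D.f t
  g := D.g
  bd t := by rw [i.setTgt_pre, D.bd]
  ne t := by
    rcases D.ne t with h | h
    · exact Or.inl (h.preimage i.et.surjective)
    · exact Or.inr h
  cov U V h h' := by
    obtain ⟨t, h1, h2⟩ := D.cov (i.et '' U) V (by
      rw [← i.setTgt_pre, Set.preimage_image_eq _ i.et.injective, h]) (by simpa using h')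
    refine ⟨t, ?_, h2⟩
    rw [← Set.preimage_image_eq U i.et.injective]
    exact Set.preimage_mono h1
  dis t t' h := by
    apply D.dis
    rcases h with ⟨x, h, h'⟩ | h
    · exact Or.inl ⟨_, h, h'⟩
    · exact Or.inr h
  pre_eq t := by
    rw [D.pre_eq, ← i.setPre_pre]
    simp only [Set.image_union, Set.image_image]
    rfl
  post_eq t := by
    rw [D.post_eq, ← i.setPost_pre]
    simp only [Set.image_union, Set.image_image]
    rfl
  src_eq t := by rw [D.src_eq, i.setSrc_pre]
  tgt_eq := D.tgt_eq

theorem tensor_congr {a b c d : ℕ} {M M' : NetB a b} {N N' : NetB c d}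
    (h : Iso M M') (h' : Iso N N') : Iso (rtensor M N) (rtensor M' N') := by
  obtain ⟨i⟩ := h
  obtain ⟨j⟩ := h'
  refine ⟨⟨Equiv.sumCongr i.ep j.ep, Equiv.sumCongr i.et j.et, ?_, ?_, ?_, ?_, ?_⟩⟩
  · rintro (t | t)
    · show Sum.inl '' M'.pre (i.et t) = _ '' (Sum.inl '' M.pre t)
      rw [i.pre_eq, Set.image_image, Set.image_image]; rfl
    · show Sum.inr '' N'.pre (j.et t) = _ '' (Sum.inr '' N.pre t)
      rw [j.pre_eq, Set.image_image, Set.image_image]; rfl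
  · rintro (t | t)
    · show Sum.inl '' M'.post (i.et t) = _ '' (Sum.inl '' M.post t)
      rw [i.post_eq, Set.image_image, Set.image_image]; rfl
    · show Sum.inr '' N'.post (j.et t) = _ '' (Sum.inr '' N.post t)
      rw [j.post_eq, Set.image_image, Set.image_image]; rfl
  · rintro (t | t)
    · exact congrArg (Set.image _) (i.src_eq t)
    · exact congrArg (Set.image _) (j.src_eq t)
  · rintro (t | t)
    · exact congrArg (Set.image _) (i.tgt_eq t)
    · exact congrArg (Set.image _) (j.tgt_eq t)
  · rintro (t | t) (u | u)
    · exact i.con_iff t u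
    · exact Iff.rfl
    · exact Iff.rfl
    · exact j.con_iff t u

theorem tensor_conEq {a b c d : ℕ} {M : NetB a b} {N : NetB c d}
    (h : ConEq M) (h' : ConEq N) : ConEq (rtensor M N) := by
  rintro (t | t) (u | u)
  · exact (h t u).trans Sum.inl_injective.eq_iff.symm
  · simp [rtensor]
  · simp [rtensor]
  · exact (h' t u).trans Sum.inr_injective.eq_iff.symm

/-- A plain net together with a set of root places. -/
structure Dat : Type 1 where
  P : Type
  T : Type
  finP : Finite P
  finT : Finite T
  pre : T → Set P
  post : T → Set P
  R : Set P

/-- The net `0 → 1` with one additional transition feeding the roots. -/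
@[reducible] def Dat.net (D : Dat) : NetB 0 1 where
  P := D.P
  T := Option D.T
  finP := D.finP
  finT := by haveI := D.finT; exact inferInstance
  pre t := match t with
    | none => ∅
    | some t => D.pre t
  post t := match t with
    | none => D.R
    | some t => D.post t
  src _ := ∅
  tgt t := match t with
    | none => {0}
    | some _ => ∅
  con t u := t = u

/-- The closed net. -/
@[reducible] def Dat.closed (D : Dat) : NetB 0 0 where
  P := D.P
  T := D.T
  finP := D.finP
  finT := D.finT
  pre := D.pre
  post := D.post
  src _ := ∅
  tgt _ := ∅
  con t u := t = u

@[reducible] def mergeNet : NetB (1 + 1) 1 where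
  P := Empty
  T := Unit
  finP := inferInstance
  finT := inferInstance
  pre _ := ∅
  post _ := ∅
  src _ := Set.univ
  tgt _ := {0}
  con t u := t = u

@[reducible] def rootNet : NetB 1 1 where
  P := Unit
  T := Bool
  finP := inferInstance
  finT := inferInstance
  pre b := if b then ∅ else Set.univ
  post b := if b then Set.univ else ∅
  src b := if b then ∅ else {0}
  tgt b := if b then {0} else ∅
  con t u := t = u

@[reducible] def closeNet : NetB 1 0 where
  P := Empty
  T := Empty
  finP := inferInstance
  finT := inferInstance
  pre _ := ∅
  post _ := ∅
  src _ := ∅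
  tgt _ := ∅
  con t u := t = u

theorem Dat.net_conEq (D : Dat) : ConEq D.net := fun _ _ => Iff.rfl

@[reducible] def Dat.sum (D E : Dat) : Dat where
  P := D.P ⊕ E.P
  T := D.T ⊕ E.T
  finP := by haveI := D.finP; haveI := E.finP; exact inferInstance
  finT := by haveI := D.finT; haveI := E.finT; exact inferInstance
  pre t := match t with
    | Sum.inl t => Sum.inl '' D.pre t
    | Sum.inr t => Sum.inr '' E.pre t
  post t := match t with
    | Sum.inl t => Sum.inl '' D.post t
    | Sum.inr t => Sum.inr '' E.post t
  R := Sum.inl '' D.R ∪ Sum.inr '' E.R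

@[reducible] def Dat.addRoot (D : Dat) : Dat where
  P := D.P ⊕ Unit
  T := Option D.T
  finP := by haveI := D.finP; exact inferInstance
  finT := by haveI := D.finT; exact inferInstance
  pre t := match t with
    | none => {Sum.inr ()}
    | some t => Sum.inl '' D.pre t
  post t := match t with
    | none => Sum.inl '' D.R
    | some t => Sum.inl '' D.post t
  R := {Sum.inr ()}

def closeDat (D : Dat) : CompDat D.net closeNet D.closed where
  ep := Equiv.sumEmpty _ _
  f t := {some t}
  g t := ∅
  bd t := by simp [setTgt, setSrc, Dat.net]
  ne t := by simp
  cov U V h h' := by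
    have hV : V = ∅ := by ext x; exact x.elim
    subst hV
    simp only [Set.not_nonempty_empty, or_false] at h'
    obtain ⟨x, hx⟩ := h'
    cases x with
    | none =>
      exfalso
      have : (0 : Fin 1) ∈ setTgt D.net U := by
        simp only [setTgt, Set.mem_iUnion]
        exact ⟨none, hx, rfl⟩
      rw [h] at this
      simp [setSrc] at this
    | some t => exact ⟨t, by simpa using hx, Set.empty_subset _⟩
  dis t t' h := by
    simp at h
    exact h.symm
  pre_eq t := by
    simp [setPre, Dat.net, Dat.closed, Set.image_image]
  post_eq t := by
    simp [setPost, Dat.net, Dat.closed, Set.image_image]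
  src_eq t := by ext x; exact x.elim0
  tgt_eq t := by ext x; exact x.elim0

def rootDat (D : Dat) : CompDat D.net rootNet D.addRoot.net where
  ep := Equiv.refl _
  f t := match t with
    | none => ∅
    | some x => {x}
  g t := match t with
    | none => {true}
    | some none => {false}
    | some (some _) => ∅
  bd t := by
    rcases t with _ | _ | t <;> simp [setTgt, setSrc, Dat.net, rootNet]
  ne t := by
    rcases t with _ | _ | t <;> simp
  cov U V h h' := by
    by_cases hs : ∃ t, some t ∈ U
    · obtain ⟨t, ht⟩ := hs
      exact ⟨some (some t), by simpa using ht, Set.empty_subset _⟩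
    by_cases ht : true ∈ V
    · exact ⟨none, Set.empty_subset _, by simpa using ht⟩
    have key : none ∈ U ↔ false ∈ V := by
      have h0 := Set.ext_iff.1 h 0
      simp only [setTgt, setSrc, Set.mem_iUnion, Dat.net, rootNet] at h0
      constructor
      · intro hn
        obtain ⟨b, hb, hb'⟩ := h0.1 ⟨none, hn, rfl⟩
        cases b
        · exact hb
        · exact absurd hb ht
      · intro hf
        obtain ⟨b, hb, hb'⟩ := h0.2 ⟨false, hf, by simp⟩
        cases b
        · exact hb
        · exact absurd hb' (by simp)
    have : none ∈ U := by
      rcases h' with ⟨x, hx⟩ | ⟨x, hx⟩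
      · cases x
        · exact hx
        · exact absurd ⟨_, hx⟩ hs
      · cases x
        · exact key.2 hx
        · exact absurd hx ht
    exact ⟨some none, by simpa using this, by simpa using key.1 this⟩
  dis t t' h := by
    rcases t with _ | _ | t <;> rcases t' with _ | _ | t' <;> simp at h ⊢
    exact h.symm
  pre_eq t := by
    rcases t with _ | _ | t <;> simp [setPre, Dat.net, Dat.addRoot, rootNet]
    ext x; rcases x with x | x <;> simp
  post_eq t := by
    rcases t with _ | _ | t <;> simp [setPost, Dat.net, Dat.addRoot, rootNet]
    ext x; rcases x with x | x <;> simp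
  src_eq t := by ext x; exact x.elim0
  tgt_eq t := by
    rcases t with _ | _ | t <;> simp [setTgt, Dat.net, rootNet]

def mergeDat (D E : Dat) : CompDat (rtensor D.net E.net) mergeNet (D.sum E).net where
  ep := Equiv.sumEmpty _ _
  f t := match t with
    | none => {Sum.inl none, Sum.inr none}
    | some (Sum.inl x) => {Sum.inl (some x)}
    | some (Sum.inr x) => {Sum.inr (some x)}
  g t := match t with
    | none => Set.univ
    | some _ => ∅
  bd t := by
    rcases t with _ | t | t
    · ext x
      simp only [setTgt, setSrc, Set.mem_iUnion, mergeNet, rtensor, Dat.net]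
      constructor
      · intro _; exact ⟨(), trivial, trivial⟩
      · intro _
        fin_cases x
        · exact ⟨Sum.inl none, by simp, 0, rfl, rfl⟩
        · exact ⟨Sum.inr none, by simp, 0, rfl, rfl⟩
    · simp [setTgt, setSrc, Dat.net, rtensor]
    · simp [setTgt, setSrc, Dat.net, rtensor]
  ne t := by
    rcases t with _ | t | t <;> simp
  cov U V h h' := by
    by_cases hs : ∃ t, Sum.inl (some t) ∈ U
    · obtain ⟨t, ht⟩ := hs
      exact ⟨some (Sum.inl t), by simpa using ht, Set.empty_subset _⟩
    by_cases hs' : ∃ t, Sum.inr (some t) ∈ U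
    · obtain ⟨t, ht⟩ := hs'
      exact ⟨some (Sum.inr t), by simpa using ht, Set.empty_subset _⟩
    have hV : () ∈ V := by
      rcases h' with ⟨x, hx⟩ | ⟨x, hx⟩
      · have : (setTgt (rtensor D.net E.net) U).Nonempty := by
          rcases x with (_ | x) | (_ | x)
          · exact ⟨Fin.castAdd 1 0, Set.mem_biUnion hx ⟨0, rfl, rfl⟩⟩
          · exact absurd ⟨_, hx⟩ hs
          · exact ⟨Fin.natAdd 1 0, Set.mem_biUnion hx ⟨0, rfl, rfl⟩⟩
          · exact absurd ⟨_, hx⟩ hs'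
        rw [h] at this
        obtain ⟨y, hy⟩ := this
        simp only [setSrc, Set.mem_iUnion] at hy
        obtain ⟨b, hb, _⟩ := hy
        exact hb
      · exact hx
    have hall : ∀ i, i ∈ setTgt (rtensor D.net E.net) U := by
      intro i
      rw [h]
      exact Set.mem_biUnion hV trivial
    refine ⟨none, ?_, fun _ _ => hV⟩
    have h0 := hall (Fin.castAdd 1 0)
    have h1 := hall (Fin.natAdd 1 0)
    simp only [setTgt, Set.mem_iUnion] at h0 h1
    rintro x (rfl | rfl)
    · obtain ⟨(_ | y) | (_ | y), hy, z, hz, hz'⟩ := h0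
      · exact hy
      · exact absurd ⟨_, hy⟩ hs
      · exact absurd (congrArg Fin.val hz') (by simp)
      · exact absurd ⟨_, hy⟩ hs'
    · obtain ⟨(_ | y) | (_ | y), hy, z, hz, hz'⟩ := h1
      · exact absurd (congrArg Fin.val hz') (by simp)
      · exact absurd ⟨_, hy⟩ hs
      · exact hy
      · exact absurd ⟨_, hy⟩ hs'
  dis t t' h := by
    rcases t with _ | t | t <;> rcases t' with _ | t' | t' <;> simp at h ⊢
    · exact h.symm
    · exact h.symm
  pre_eq t := by
    rcases t with _ | t | t <;>
      simp [setPre, Dat.net, Dat.sum, mergeNet, rtensor, Set.image_image]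
  post_eq t := by
    rcases t with _ | t | t <;>
      simp [setPost, Dat.net, Dat.sum, mergeNet, rtensor, Set.image_image, Set.image_union,
        Set.biUnion_insert]
  src_eq t := by ext x; exact x.elim0
  tgt_eq t := by
    rcases t with _ | t | t <;> simp [setTgt, Dat.net, mergeNet]

theorem Dat.net_iso {D E : Dat} (ep : D.P ≃ E.P) (et : D.T ≃ E.T)
    (h1 : ∀ t, E.pre (et t) = ep '' D.pre t) (h2 : ∀ t, E.post (et t) = ep '' D.post t)
    (h3 : E.R = ep '' D.R) : Iso D.net E.net := by
  refine ⟨⟨ep, et.optionCongr, ?_, ?_, ?_, ?_, ?_⟩⟩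
  · rintro (_ | t)
    · simp [Dat.net]
    · exact h1 t
  · rintro (_ | t)
    · exact h3
    · exact h2 t
  · intro t; rfl
  · rintro (_ | t) <;> rfl
  · intro t u
    exact et.optionCongr.apply_eq_iff_eq

/-! Trees and forests -/

@[reducible] def treeDat (n k : ℕ) : Dat where
  P := (rtreeD n k).P
  T := (rtreeD n k).T
  finP := (rtreeD n k).finP
  finT := (rtreeD n k).finT
  pre := (rtreeD n k).pre
  post := (rtreeD n k).post
  R := {⟨[], Nat.zero_le _⟩}

@[reducible] def forestDat (n k j : ℕ) : Dat where
  P := Fin j × (rtreeD n k).P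
  T := Fin j × (rtreeD n k).T
  finP := by haveI := (rtreeD n k).finP; exact inferInstance
  finT := by haveI := (rtreeD n k).finT; exact inferInstance
  pre t := Prod.mk t.1 '' (rtreeD n k).pre t.2
  post t := Prod.mk t.1 '' (rtreeD n k).post t.2
  R := {p | p.2.1 = []}

/-- `Fin j × X ⊕ X ≃ Fin (j+1) × X`. -/
def stepEquiv (j : ℕ) (X : Type) : (Fin j × X) ⊕ X ≃ Fin (j + 1) × X where
  toFun s := match s with
    | Sum.inl p => (p.1.succ, p.2)
    | Sum.inr x => (0, x)
  invFun p := Fin.cases (motive := fun _ => (Fin j × X) ⊕ X) (Sum.inr p.2)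
    (fun i => Sum.inl (i, p.2)) p.1
  left_inv := by rintro (⟨i, x⟩ | x) <;> rfl
  right_inv := by
    rintro ⟨i, x⟩
    induction i using Fin.cases <;> rfl

theorem forest_succ (n k j : ℕ) :
    Iso ((forestDat n k j).sum (treeDat n k)).net (forestDat n k (j + 1)).net := by
  apply Dat.net_iso (stepEquiv j _) (stepEquiv j _)
  · rintro (⟨i, t⟩ | t) <;>
      simp [Dat.sum, forestDat, treeDat, Set.image_image, stepEquiv]
  · rintro (⟨i, t⟩ | t) <;>
      simp [Dat.sum, forestDat, treeDat, Set.image_image, stepEquiv]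
  · ext ⟨i, x⟩
    obtain ⟨y, hy⟩ := (stepEquiv j (rtreeD n k).P).surjective (i, x)
    rw [← hy]
    erw [(stepEquiv j (rtreeD n k).P).injective.mem_set_image]
    rcases y with ⟨a, y⟩ | y
    · simp [Dat.sum, forestDat, treeDat, stepEquiv]
    · simp [Dat.sum, forestDat, treeDat, stepEquiv]
      exact (Subtype.ext_iff (a1 := y) (a2 := ⟨[], Nat.zero_le _⟩)).symm

def consP (n k : ℕ) : (Fin n × {l : List (Fin n) // l.length ≤ k}) ⊕ Unit ≃
    {l : List (Fin n) // l.length ≤ k + 1} where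
  toFun s := match s with
    | Sum.inl p => ⟨p.1 :: p.2.1, by simpa using p.2.2⟩
    | Sum.inr _ => ⟨[], Nat.zero_le _⟩
  invFun l := match l with
    | ⟨[], _⟩ => Sum.inr ()
    | ⟨i :: l, h⟩ => Sum.inl (i, ⟨l, by simpa using h⟩)
  left_inv := by rintro (⟨i, x⟩ | x) <;> rfl
  right_inv := by rintro ⟨_ | ⟨i, l⟩, h⟩ <;> rfl

def consT (n k : ℕ) : Option (Fin n × {l : List (Fin n) // l.length < k}) ≃
    {l : List (Fin n) // l.length < k + 1} where
  toFun s := match s with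
    | some p => ⟨p.1 :: p.2.1, by simpa using p.2.2⟩
    | none => ⟨[], Nat.succ_pos _⟩
  invFun l := match l with
    | ⟨[], _⟩ => none
    | ⟨i :: l, h⟩ => some (i, ⟨l, by simpa using h⟩)
  left_inv := by rintro (_ | ⟨i, x⟩) <;> rfl
  right_inv := by rintro ⟨_ | ⟨i, l⟩, h⟩ <;> rfl

theorem tree_succ (n k : ℕ) :
    Iso (forestDat n k n).addRoot.net (treeDat n (k + 1)).net := by
  apply Dat.net_iso (consP n k) (consT n k)
  · rintro (_ | ⟨i, t⟩)
    · simp [Dat.addRoot, forestDat, treeDat, rtreeD, consP, consT]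
    · simp [Dat.addRoot, forestDat, treeDat, rtreeD, consP, consT]
  · rintro (_ | ⟨i, t⟩)
    · ext x
      obtain ⟨y, rfl⟩ := (consP n k).surjective x
      erw [(consP n k).injective.mem_set_image]
      rcases y with ⟨a, y⟩ | y <;>
        simp [Dat.addRoot, forestDat, treeDat, rtreeD, consP, consT]
    · ext x
      obtain ⟨y, rfl⟩ := (consP n k).surjective x
      erw [(consP n k).injective.mem_set_image]
      rcases y with ⟨a, y⟩ | y
      · simp [Dat.addRoot, forestDat, treeDat, rtreeD, consP, consT]
        grind
      · simp [Dat.addRoot, forestDat, treeDat, rtreeD, consP, consT]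
  · simp [Dat.addRoot, treeDat, consP]

theorem forest_zero (n k n' k' : ℕ) : Iso (forestDat n k 0).net (forestDat n' k' 0).net := by
  haveI (X : Type) : IsEmpty (Fin 0 × X) := inferInstance
  apply Dat.net_iso (D := forestDat n k 0) (E := forestDat n' k' 0)
    (Equiv.equivOfIsEmpty (Fin 0 × _) (Fin 0 × _)) (Equiv.equivOfIsEmpty (Fin 0 × _) (Fin 0 × _))
  · intro t; exact t.1.elim0
  · intro t; exact t.1.elim0
  · ext x; exact x.1.elim0

/-! The decomposition -/

def asg (n : ℕ) : Fin 5 → NetS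
  | 0 => ⟨0, 1, (treeDat n 0).net⟩
  | 1 => ⟨0, 1, (forestDat n 0 0).net⟩
  | 2 => ⟨1 + 1, 1, mergeNet⟩
  | 3 => ⟨1, 1, rootNet⟩
  | 4 => ⟨1, 0, closeNet⟩

theorem castNet_rfl {k l : ℕ} (N : NetB k l) : castNet rfl rfl N = N := by
  cases N
  simp [castNet]

theorem seqS_mk {a b c : ℕ} (M : NetB a b) (N : NetB b c) :
    seqS ⟨a, b, M⟩ ⟨b, c, N⟩ = ⟨a, c, comp M N⟩ := by
  simp only [seqS, castNet_rfl]
  exact dif_pos rfl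

def Rep (n : ℕ) (D : Dat) : Prop :=
  ∃ (t : WExpr (Fin 5)) (N : NetB 0 1), sem (asg n) t = ⟨0, 1, N⟩ ∧ WT (asg n) t ∧
    HasWidth (asg n) 2 t ∧ Iso N D.net

theorem Rep.iso {n : ℕ} {D E : Dat} (h : Rep n D) (i : Iso D.net E.net) : Rep n E := by
  obtain ⟨t, N, h1, h2, h3, h4⟩ := h
  exact ⟨t, N, h1, h2, h3, h4.trans i⟩

theorem mergeNet_conEq : ConEq mergeNet := fun _ _ => Iff.rfl
theorem rootNet_conEq : ConEq rootNet := fun _ _ => Iff.rfl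
theorem closeNet_conEq : ConEq closeNet := fun _ _ => Iff.rfl

theorem Rep.sum {n : ℕ} {D E : Dat} (h : Rep n D) (h' : Rep n E) : Rep n (D.sum E) := by
  obtain ⟨t, N, h1, h2, h3, h4⟩ := h
  obtain ⟨t', N', h1', h2', h3', h4'⟩ := h'
  have s1 : sem (asg n) (.ten t t') = ⟨0 + 0, 1 + 1, tensor N N'⟩ := by
    simp only [sem, h1, h1']; rfl
  have s2 : sem (asg n) (.seq (.ten t t') (.leaf 2)) = ⟨0, 1, comp (tensor N N') mergeNet⟩ := by
    rw [sem, s1]; exact seqS_mk _ _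
  refine ⟨.seq (.ten t t') (.leaf 2), _, s2, ⟨⟨h2, h2'⟩, trivial, ?_⟩,
    ⟨⟨h3, h3', ?_, ?_⟩, ⟨?_, ?_, ?_⟩, ?_, ?_⟩, ?_⟩
  · rw [s1]; rfl
  · rw [s1]; simp
  · rw [s1]
  · simp [asg]
  · simp [asg, mergeNet]
  · simp [asg]
  · rw [s2]; simp
  · rw [s2]; simp
  · have hi : Iso (tensor N N') (rtensor D.net E.net) := tensor_congr h4 h4'
    have hc := tensor_conEq D.net_conEq E.net_conEq
    exact hi.elim fun i => ((mergeDat D E).left i).iso (i.conEq hc) mergeNet_conEq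
      (Dat.net_conEq _)

theorem Rep.addRoot {n : ℕ} {D : Dat} (h : Rep n D) : Rep n D.addRoot := by
  obtain ⟨t, N, h1, h2, h3, h4⟩ := h
  have s2 : sem (asg n) (.seq t (.leaf 3)) = ⟨0, 1, comp N rootNet⟩ := by
    rw [sem, h1]; exact seqS_mk _ _
  refine ⟨.seq t (.leaf 3), _, s2, ⟨h2, trivial, ?_⟩, ⟨h3, ⟨?_, ?_, ?_⟩, ?_, ?_⟩, ?_⟩
  · rw [h1]; rfl
  · simp [asg]
  · simp [asg, rootNet]
  · simp [asg]
  · rw [s2]; simp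
  · rw [s2]; simp
  · exact h4.elim fun i => ((rootDat D).left i).iso (i.conEq D.net_conEq) rootNet_conEq
      (Dat.net_conEq _)

theorem rep_forest (n k j : ℕ) (h : Rep n (treeDat n k)) : Rep n (forestDat n k j) := by
  induction j with
  | zero =>
    have : Rep n (forestDat n 0 0) := by
      refine ⟨.leaf 1, _, rfl, trivial, ⟨?_, ?_, ?_⟩, ?_⟩
      · simp [asg]
      · simp [asg, forestDat, Dat.net]
      · simp [asg]
      · exact ⟨⟨Equiv.refl _, Equiv.refl _, by simp, by simp, by simp, by simp, by simp⟩⟩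
    exact this.iso (forest_zero _ _ _ _)
  | succ j ih => exact (ih.sum h).iso (forest_succ n k j)

theorem rep_tree (n k : ℕ) : Rep n (treeDat n k) := by
  induction k with
  | zero =>
    refine ⟨.leaf 0, _, rfl, trivial, ⟨?_, ?_, ?_⟩, ?_⟩
    · simp [asg]
    · have : Subsingleton (rtreeD n 0).P := by
        constructor
        rintro ⟨a, ha⟩ ⟨b, hb⟩
        apply Subtype.ext
        simp only [Nat.le_zero, List.length_eq_zero_iff] at ha hb
        simp [ha, hb]
      have h1 : Nat.card (rtreeD n 0).P ≤ 1 := Finite.card_le_one_iff_subsingleton.2 this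
      exact h1.trans one_le_two
    · simp [asg]
    · exact ⟨⟨Equiv.refl _, Equiv.refl _, by simp, by simp, by simp, by simp, by simp⟩⟩
  | succ k ih => exact (rep_forest n k n ih).addRoot.iso (tree_succ n k)

theorem isContention_of {k l : ℕ} {N : NetB k l} (h : ConEq N)
    (h' : ∀ t u : N.T, ((N.pre t ∩ N.pre u).Nonempty ∨ (N.post t ∩ N.post u).Nonempty ∨
     (N.src t ∩ N.src u).Nonempty ∨ (N.tgt t ∩ N.tgt u).Nonempty) → t = u) :
    IsContention N :=
  ⟨fun t => (h t t).2 rfl, fun t u e => (h u t).2 ((h t u).1 e).symm,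
    fun t u e => (h t u).2 (h' t u e)⟩

theorem asg_contention (n : ℕ) (x : Fin 5) : IsContention (asg n x).2.2 := by
  fin_cases x
  · apply isContention_of (Dat.net_conEq _)
    rintro (_ | ⟨t, ht⟩) (_ | ⟨u, hu⟩) _
    · rfl
    · exact absurd hu (Nat.not_lt_zero _)
    · exact absurd ht (Nat.not_lt_zero _)
    · exact absurd ht (Nat.not_lt_zero _)
  · apply isContention_of (Dat.net_conEq _)
    rintro (_ | ⟨t, ht⟩) (_ | ⟨u, hu⟩) _
    · rfl
    · exact u.elim0
    · exact t.elim0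
    · exact t.elim0
  · exact isContention_of mergeNet_conEq fun t u _ => rfl
  · apply isContention_of rootNet_conEq
    rintro (_ | _) (_ | _) <;> simp [rootNet]
  · exact isContention_of closeNet_conEq fun t u _ => t.elim

/-- for all `n, k ≥ 1`, the tree net `T_Δ^{n,k}` has
decomposition width 2. -/
theorem treeD_decompWidth (n k : ℕ) (hn : 1 ≤ n) (hk : 1 ≤ k) :
    HasDecompWidth (treeD n k) 2 := by
  obtain ⟨t, N, h1, h2, h3, h4⟩ := rep_tree n k
  have s2 : sem (asg n) (.seq t (.leaf 4)) = ⟨0, 0, comp N closeNet⟩ := by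
    rw [sem, h1]; exact seqS_mk _ _
  have hi : Iso (comp N closeNet) (treeD n k) :=
    h4.elim fun i => ((closeDat (treeDat n k)).left i).iso (i.conEq (Dat.net_conEq _))
      closeNet_conEq (fun _ _ => Iff.rfl)
  refine ⟨Fin 5, asg n, .seq t (.leaf 4), ⟨asg_contention n, ⟨h2, trivial, ?_⟩, ?_⟩,
    ⟨h3, ⟨?_, ?_, ?_⟩, ?_, ?_⟩⟩
  · rw [h1]; rfl
  · rw [s2]
    refine ⟨rfl, rfl, ?_⟩
    rw [castNet_rfl]
    exact hi
  · simp [asg]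
  · simp [asg, closeNet]
  · simp [asg]
  · rw [s2]; simp
  · rw [s2]; simp

end NWB
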